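/- For every N > 0 there exist positive constants ε₀ and d₀ such that for all ε ∈ (0, ε₀] and all b ≥ 0 with ε·b ≥ d₀, one has λ(ε, b) ≥ N. (In the thin-domain limit, the lowest magnetic Neumann eigenvalue blows up when the field strength is large compared with the inverse thickness.) -/

import Mathlib

open MeasureTheory Real Set

noncomputable section

/-- The thin tubular neighbourhood `Ω_ε = {x ∈ Ω : dist(x, ∂Ω) < ε}`. -/
def OmegaEps (Ω : Set (ℝ × ℝ)) (ε : ℝ) : Set (ℝ × ℝ) :=
  {x | x ∈ Ω ∧ Metric.infDist x (frontier Ω) < ε}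

/-- `M` is a `C²`, `2L`-periodic, unit-speed parameterization of `∂Ω`,
injective on a period. -/
def BoundaryParam (Ω : Set (ℝ × ℝ)) (L : ℝ) (M : ℝ → ℝ × ℝ) : Prop :=
  ContDiff ℝ 2 M ∧ Function.Periodic M (2 * L) ∧
  (∀ s : ℝ, (deriv M s).1 ^ 2 + (deriv M s).2 ^ 2 = 1) ∧
  Set.InjOn M (Set.Ico 0 (2 * L)) ∧ Set.range M = frontier Ω

/-- The scalar curl `∂₁A₂ − ∂₂A₁` of a planar vector field. -/
def curl2 (A : ℝ × ℝ → ℝ × ℝ) (x : ℝ × ℝ) : ℝ :=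
  fderiv ℝ (fun y => (A y).2) x (1, 0) - fderiv ℝ (fun y => (A y).1) x (0, 1)

/-- `f` is `C¹` on an open neighbourhood of the closure of `S`. -/
def C1Nhd {E : Type*} [NormedAddCommGroup E] [NormedSpace ℝ E]
    (f : ℝ × ℝ → E) (S : Set (ℝ × ℝ)) : Prop :=
  ∃ U : Set (ℝ × ℝ), IsOpen U ∧ closure S ⊆ U ∧ ContDiffOn ℝ 1 f U

/-- The pointwise squared magnetic gradient `|(∇ − i b A)u|²`. -/
def mgNormSq (b : ℝ) (A : ℝ × ℝ → ℝ × ℝ) (u : ℝ × ℝ → ℂ) (x : ℝ × ℝ) : ℝ :=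
  ‖fderiv ℝ u x (1, 0) - Complex.I * (b : ℂ) * ((A x).1 : ℂ) * u x‖ ^ 2 +
  ‖fderiv ℝ u x (0, 1) - Complex.I * (b : ℂ) * ((A x).2 : ℂ) * u x‖ ^ 2

/-- The lowest magnetic Neumann eigenvalue of `−(∇ − i b A)²` on `Ω_ε`,
characterized variationally as the infimum of Rayleigh quotients. -/
def lam (Ω : Set (ℝ × ℝ)) (A : ℝ × ℝ → ℝ × ℝ) (ε b : ℝ) : ℝ :=
  sInf { r : ℝ | ∃ u : ℝ × ℝ → ℂ, C1Nhd u (OmegaEps Ω ε) ∧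
    (0 < ∫ x in OmegaEps Ω ε, ‖u x‖ ^ 2) ∧
    r = (∫ x in OmegaEps Ω ε, mgNormSq b A u x) /
        (∫ x in OmegaEps Ω ε, ‖u x‖ ^ 2) }

/-- The circulation `γ₀ = |Ω| / |∂Ω|` with `|∂Ω| = 2L`. -/
def gamma0 (Ω : Set (ℝ × ℝ)) (L : ℝ) : ℝ := (volume Ω).toReal / (2 * L)

/-- `i₀(c, a, ε) = inf_{n ∈ ℤ} |n + (L/π)(γ₀(a/ε + c) + a/2)|`. -/
def i0 (L γ₀ c a ε : ℝ) : ℝ :=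
  ⨅ n : ℤ, |(n : ℝ) + (L / π) * (γ₀ * (a / ε + c) + a / 2)|

/-- `e₀(c, a, ε) = a²/12 + (π i₀/L)²`. -/
def e0 (L γ₀ c a ε : ℝ) : ℝ :=
  a ^ 2 / 12 + (π * i0 L γ₀ c a ε / L) ^ 2

/-- The Ginzburg–Landau energy of the pair `(ψ, A')`. -/
def GLenergy (Ω : Set (ℝ × ℝ)) (κ H ε : ℝ) (ψ : ℝ × ℝ → ℂ)
    (A' : ℝ × ℝ → ℝ × ℝ) : ℝ :=
  (∫ x in OmegaEps Ω ε,
      (mgNormSq H A' ψ x - κ ^ 2 * ‖ψ x‖ ^ 2 + κ ^ 2 / 2 * ‖ψ x‖ ^ 4)) +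
  H ^ 2 * ∫ x in Ω, (curl2 A' x - 1) ^ 2

/-- Admissible Ginzburg–Landau configurations. -/
def GLadm (Ω : Set (ℝ × ℝ)) (ε : ℝ) (ψ : ℝ × ℝ → ℂ)
    (A' : ℝ × ℝ → ℝ × ℝ) : Prop :=
  C1Nhd ψ (OmegaEps Ω ε) ∧ C1Nhd A' Ω

/-- The Ginzburg–Landau ground-state energy. -/
def Egs (Ω : Set (ℝ × ℝ)) (κ H ε : ℝ) : ℝ :=
  sInf { E : ℝ | ∃ ψ A', GLadm Ω ε ψ A' ∧ E = GLenergy Ω κ H ε ψ A' }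

lemma aux_sq_integral (f : ℝ → ℝ) (hf : ContinuousOn f (Icc 0 1)) :
    (∫ s in (0:ℝ)..1, f s) ^ 2 ≤ ∫ s in (0:ℝ)..1, f s ^ 2 := by
  have hf' : ContinuousOn f (uIcc 0 1) := by simpa using hf
  set c := ∫ s in (0:ℝ)..1, f s with hc
  have h0 : 0 ≤ ∫ s in (0:ℝ)..1, (f s - c) ^ 2 :=
    intervalIntegral.integral_nonneg (by norm_num) (fun s _ => sq_nonneg _)
  have h1 : IntervalIntegrable (fun s => f s ^ 2) volume 0 1 := (hf'.pow 2).intervalIntegrable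
  have h2 : IntervalIntegrable (fun s => 2 * c * f s) volume 0 1 :=
    (continuousOn_const.mul hf').intervalIntegrable
  have h3 : ∫ s in (0:ℝ)..1, (f s - c) ^ 2
      = (∫ s in (0:ℝ)..1, f s ^ 2) - 2 * c * c + c ^ 2 := by
    have : (fun s => (f s - c) ^ 2) = fun s => (f s ^ 2 - 2 * c * f s) + c ^ 2 := by
      funext s; ring
    rw [this, intervalIntegral.integral_add (h1.sub h2) (by simp),
      intervalIntegral.integral_sub h1 h2, intervalIntegral.integral_const_mul, ← hc]
    simp
  nlinarith

lemma aux_transport0 (g g' : ℝ → ℂ) (a : ℝ → ℝ) (ha : Continuous a)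
    (hg' : ContinuousOn g' (Icc 0 1)) (hg : ∀ s ∈ Icc (0:ℝ) 1, HasDerivAt g (g' s) s) :
    ‖g 1 - Complex.exp (Complex.I * ((∫ s in (0:ℝ)..1, a s : ℝ) : ℂ)) * g 0‖ ^ 2
      ≤ ∫ s in (0:ℝ)..1, ‖g' s - Complex.I * (a s : ℂ) * g s‖ ^ 2 := by
  have hgc : ContinuousOn g (Icc 0 1) := fun s hs => (hg s hs).continuousAt.continuousWithinAt
  set φ : ℝ → ℝ := fun s => ∫ r in (0:ℝ)..s, a r with hφ
  have hφd : ∀ s, HasDerivAt φ (a s) s := fun s => (ha.integral_hasStrictDerivAt 0 s).hasDerivAt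
  have hφc : Continuous φ := continuous_iff_continuousAt.2 fun s => (hφd s).continuousAt
  have hφ0 : φ 0 = 0 := by simp [hφ]
  set E : ℝ → ℂ := fun s => Complex.exp (-(Complex.I * (φ s : ℂ))) with hE
  have hEn : ∀ s, ‖E s‖ = 1 := by
    intro s
    simp only [hE]
    have := Complex.norm_exp_I_mul_ofReal (-φ s)
    push_cast at this
    rwa [mul_neg] at this
  have hEd : ∀ s, HasDerivAt E (E s * (-(Complex.I * (a s : ℂ)))) s := by
    intro s
    exact (((hφd s).ofReal_comp.const_mul Complex.I).neg).cexp
  have hEc : Continuous E := continuous_iff_continuousAt.2 fun s => (hEd s).continuousAt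
  set k : ℝ → ℂ := fun s => g' s - Complex.I * (a s : ℂ) * g s with hk
  have hkc : ContinuousOn k (Icc 0 1) := by
    apply hg'.sub
    apply ContinuousOn.mul _ hgc
    exact (continuous_const.mul (Complex.continuous_ofReal.comp ha)).continuousOn
  have hd : ∀ s ∈ uIcc (0:ℝ) 1, HasDerivAt (fun s => E s * g s) (E s * k s) s := by
    intro s hs
    have hs' : s ∈ Icc (0:ℝ) 1 := by simpa using hs
    have e : E s * k s = E s * (-(Complex.I * (a s : ℂ))) * g s + E s * g' s := by
      simp only [hk]; ring
    rw [e]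
    exact (hEd s).mul (hg s hs')
  have hEk : ContinuousOn (fun s => E s * k s) (uIcc 0 1) := by
    rw [uIcc_of_le zero_le_one]; exact hEc.continuousOn.mul hkc
  have hF := intervalIntegral.integral_eq_sub_of_hasDerivAt hd hEk.intervalIntegrable
  have hE0 : E 0 = 1 := by simp [hE, hφ0]
  have hE1 : Complex.exp (Complex.I * ((∫ s in (0:ℝ)..1, a s : ℝ) : ℂ)) * E 1 = 1 := by
    simp only [hE, hφ]
    rw [← Complex.exp_add]; simp
  have hnorm : ‖g 1 - Complex.exp (Complex.I * ((∫ s in (0:ℝ)..1, a s : ℝ) : ℂ)) * g 0‖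
      ≤ ∫ s in (0:ℝ)..1, ‖k s‖ := by
    have e1 : g 1 - Complex.exp (Complex.I * ((∫ s in (0:ℝ)..1, a s : ℝ) : ℂ)) * g 0
        = Complex.exp (Complex.I * ((∫ s in (0:ℝ)..1, a s : ℝ) : ℂ)) * (E 1 * g 1 - E 0 * g 0) := by
      rw [mul_sub, ← mul_assoc, hE1, hE0]; ring
    rw [e1, norm_mul, Complex.norm_exp_I_mul_ofReal, one_mul, ← hF]
    refine (intervalIntegral.norm_integral_le_integral_norm zero_le_one).trans ?_
    simp [hEn]
  calc _ ≤ (∫ s in (0:ℝ)..1, ‖k s‖) ^ 2 := by gcongr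
    _ ≤ _ := aux_sq_integral _ hkc.norm

lemma aux_transport (g g' : ℝ → ℂ) (a : ℝ → ℝ) (ha : ContinuousOn a (Icc 0 1))
    (hg' : ContinuousOn g' (Icc 0 1)) (hg : ∀ s ∈ Icc (0:ℝ) 1, HasDerivAt g (g' s) s) :
    ‖g 1 - Complex.exp (Complex.I * ((∫ s in (0:ℝ)..1, a s : ℝ) : ℂ)) * g 0‖ ^ 2
      ≤ ∫ s in (0:ℝ)..1, ‖g' s - Complex.I * (a s : ℂ) * g s‖ ^ 2 := by
  have hc : Continuous (IccExtend (zero_le_one' ℝ) ((Icc 0 1).domRestrict a)) :=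
    (continuousOn_iff_continuous_domRestrict.1 ha).Icc_extend'
  have he : ∀ s ∈ uIcc (0:ℝ) 1, IccExtend (zero_le_one' ℝ) ((Icc 0 1).domRestrict a) s = a s := by
    intro s hs
    rw [uIcc_of_le zero_le_one] at hs
    rw [IccExtend_of_mem _ _ hs]; rfl
  have := aux_transport0 g g' _ hc hg' hg
  rw [intervalIntegral.integral_congr he] at this
  refine this.trans (le_of_eq ?_)
  apply intervalIntegral.integral_congr
  intro s hs
  simp only [he s hs]

/-- The covariant derivative of `u` at `y` in direction `v`. -/
def covD (b : ℝ) (A : ℝ × ℝ → ℝ × ℝ) (u : ℝ × ℝ → ℂ) (v y : ℝ × ℝ) : ℂ :=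
  fderiv ℝ u y v - Complex.I * ((b * ((A y).1 * v.1 + (A y).2 * v.2) : ℝ) : ℂ) * u y

lemma covD_le (b : ℝ) (A : ℝ × ℝ → ℝ × ℝ) (u : ℝ × ℝ → ℂ) (v y : ℝ × ℝ) :
    ‖covD b A u v y‖ ^ 2 ≤ (v.1 ^ 2 + v.2 ^ 2) * mgNormSq b A u y := by
  have hv : v = v.1 • (1, 0) + v.2 • (0, 1) := by ext <;> simp
  have e : covD b A u v y
      = (v.1 : ℂ) * (fderiv ℝ u y (1, 0) - Complex.I * (b : ℂ) * ((A y).1 : ℂ) * u y)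
      + (v.2 : ℂ) * (fderiv ℝ u y (0, 1) - Complex.I * (b : ℂ) * ((A y).2 : ℂ) * u y) := by
    have : fderiv ℝ u y v = (v.1 : ℂ) * fderiv ℝ u y (1, 0) + (v.2 : ℂ) * fderiv ℝ u y (0, 1) := by
      conv_lhs => rw [hv, map_add, map_smul, map_smul]
      simp
    unfold covD
    rw [this]; push_cast; ring
  rw [e, mgNormSq]
  set X := fderiv ℝ u y (1, 0) - Complex.I * (b : ℂ) * ((A y).1 : ℂ) * u y
  set Y := fderiv ℝ u y (0, 1) - Complex.I * (b : ℂ) * ((A y).2 : ℂ) * u y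
  have h1 : ‖(v.1 : ℂ) * X + (v.2 : ℂ) * Y‖ ≤ |v.1| * ‖X‖ + |v.2| * ‖Y‖ := by
    refine (norm_add_le _ _).trans (le_of_eq ?_)
    simp
  calc _ ≤ (|v.1| * ‖X‖ + |v.2| * ‖Y‖) ^ 2 := by gcongr
    _ ≤ (|v.1| ^ 2 + |v.2| ^ 2) * (‖X‖ ^ 2 + ‖Y‖ ^ 2) := by
      nlinarith [sq_nonneg (|v.1| * ‖Y‖ - |v.2| * ‖X‖)]
    _ = _ := by simp only [sq_abs]

/-- Circulation along a segment. -/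
def circ (A : ℝ × ℝ → ℝ × ℝ) (p v : ℝ × ℝ) : ℝ :=
  ∫ s in (0:ℝ)..1, ((A (p + s • v)).1 * v.1 + (A (p + s • v)).2 * v.2)

lemma aux_seg (b : ℝ) (A : ℝ × ℝ → ℝ × ℝ) (u : ℝ × ℝ → ℂ) (U : Set (ℝ × ℝ)) (hU : IsOpen U)
    (hA : ContDiffOn ℝ 1 A U) (hu : ContDiffOn ℝ 1 u U) (p v : ℝ × ℝ)
    (hp : ∀ s ∈ Icc (0:ℝ) 1, p + s • v ∈ U) :
    ‖u (p + v) - Complex.exp (Complex.I * ((b * circ A p v : ℝ) : ℂ)) * u p‖ ^ 2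
      ≤ ∫ s in (0:ℝ)..1, ‖covD b A u v (p + s • v)‖ ^ 2 := by
  have hcl : Continuous (fun s : ℝ => p + s • v) := by fun_prop
  have hAc : ContinuousOn (fun s : ℝ => A (p + s • v)) (Icc 0 1) :=
    hA.continuousOn.comp hcl.continuousOn hp
  have hfu : ContinuousOn (fun s : ℝ => fderiv ℝ u (p + s • v)) (Icc 0 1) :=
    (hu.continuousOn_fderiv_of_isOpen hU le_rfl).comp hcl.continuousOn hp
  have h := aux_transport (fun s => u (p + s • v)) (fun s => fderiv ℝ u (p + s • v) v)
    (fun s => b * ((A (p + s • v)).1 * v.1 + (A (p + s • v)).2 * v.2))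
    (continuousOn_const.mul ((hAc.fst.mul continuousOn_const).add (hAc.snd.mul continuousOn_const)))
    (by fun_prop) (by
      intro s hs
      have hd : HasFDerivAt u (fderiv ℝ u (p + s • v)) (p + s • v) :=
        ((hu.contDiffAt (hU.mem_nhds (hp s hs))).differentiableAt one_ne_zero).hasFDerivAt
      have hl : HasDerivAt (fun s : ℝ => p + s • v) v s := by
        simpa using ((hasDerivAt_id s).smul_const v).const_add p
      exact hd.comp_hasDerivAt s hl)
  rw [intervalIntegral.integral_const_mul] at h
  simpa [circ, covD] using h

lemma aux_curl (A : ℝ × ℝ → ℝ × ℝ) (y v w : ℝ × ℝ) (hA : DifferentiableAt ℝ A y) :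
    ((fderiv ℝ A y v).1 * w.1 + (fderiv ℝ A y v).2 * w.2)
      - ((fderiv ℝ A y w).1 * v.1 + (fderiv ℝ A y w).2 * v.2)
      = curl2 A y * (v.1 * w.2 - v.2 * w.1) := by
  have h1 : ∀ z, fderiv ℝ (fun y => (A y).1) y z = (fderiv ℝ A y z).1 := by
    intro z; rw [hA.hasFDerivAt.fst.fderiv]; rfl
  have h2 : ∀ z, fderiv ℝ (fun y => (A y).2) y z = (fderiv ℝ A y z).2 := by
    intro z; rw [hA.hasFDerivAt.snd.fderiv]; rfl
  have hz : ∀ z : ℝ × ℝ, fderiv ℝ A y z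
      = z.1 • fderiv ℝ A y (1, 0) + z.2 • fderiv ℝ A y (0, 1) := by
    intro z
    have hv : z = z.1 • (1, 0) + z.2 • (0, 1) := by ext <;> simp
    conv_lhs => rw [hv, map_add, map_smul, map_smul]
  rw [curl2, h1, h2, hz v, hz w]
  simp only [Prod.fst_add, Prod.snd_add, Prod.smul_fst, Prod.smul_snd, smul_eq_mul]
  ring

lemma aux_flux (A : ℝ × ℝ → ℝ × ℝ) (U : Set (ℝ × ℝ)) (hU : IsOpen U)
    (hA : ContDiffOn ℝ 1 A U) (x v w : ℝ × ℝ)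
    (hp : ∀ s ∈ Icc (0:ℝ) 1, ∀ t ∈ Icc (0:ℝ) 1, x + s • v + t • w ∈ U)
    (hcurl : ∀ s ∈ Icc (0:ℝ) 1, ∀ t ∈ Icc (0:ℝ) 1, curl2 A (x + s • v + t • w) = 1) :
    circ A x v + circ A (x + v) w - circ A x w - circ A (x + w) v = v.1 * w.2 - v.2 * w.1 := by
  set F : ℝ × ℝ → ℝ × ℝ := fun q => x + q.1 • v + q.2 • w with hF
  have hFd : ∀ q, HasFDerivAt F ((ContinuousLinearMap.fst ℝ ℝ ℝ).smulRight v
      + (ContinuousLinearMap.snd ℝ ℝ ℝ).smulRight w) q := by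
    intro q
    have h1 : HasFDerivAt (fun q : ℝ × ℝ => q.1 • v)
        ((ContinuousLinearMap.fst ℝ ℝ ℝ).smulRight v) q :=
      ((ContinuousLinearMap.fst ℝ ℝ ℝ).smulRight v).hasFDerivAt
    have h2 : HasFDerivAt (fun q : ℝ × ℝ => q.2 • w)
        ((ContinuousLinearMap.snd ℝ ℝ ℝ).smulRight w) q :=
      ((ContinuousLinearMap.snd ℝ ℝ ℝ).smulRight w).hasFDerivAt
    exact (h1.const_add x).add h2
  set FL : ℝ × ℝ →L[ℝ] ℝ × ℝ := (ContinuousLinearMap.fst ℝ ℝ ℝ).smulRight v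
      + (ContinuousLinearMap.snd ℝ ℝ ℝ).smulRight w with hFL
  have hFLs : FL (1, 0) = v := by simp [hFL]
  have hFLt : FL (0, 1) = w := by simp [hFL]
  have hFc : Continuous F := continuous_iff_continuousAt.2 fun q => (hFd q).continuousAt
  have hmem : ∀ q ∈ Icc (0:ℝ) 1 ×ˢ Icc (0:ℝ) 1, F q ∈ U := fun q hq => hp _ hq.1 _ hq.2
  have hAd : ∀ q ∈ Icc (0:ℝ) 1 ×ˢ Icc (0:ℝ) 1, DifferentiableAt ℝ A (F q) := fun q hq =>
    (hA.contDiffAt (hU.mem_nhds (hmem q hq))).differentiableAt one_ne_zero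
  have hAc : ContinuousOn (fun q => A (F q)) (Icc (0:ℝ) 1 ×ˢ Icc (0:ℝ) 1) :=
    hA.continuousOn.comp hFc.continuousOn hmem
  set dot : ℝ × ℝ → (ℝ × ℝ →L[ℝ] ℝ) := fun z =>
    z.1 • ContinuousLinearMap.fst ℝ ℝ ℝ + z.2 • ContinuousLinearMap.snd ℝ ℝ ℝ with hdot
  have hdotv : ∀ z y : ℝ × ℝ, dot z y = y.1 * z.1 + y.2 * z.2 := by
    intro z y; simp [hdot]; ring
  have hder : ∀ z, ∀ q ∈ Icc (0:ℝ) 1 ×ˢ Icc (0:ℝ) 1,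
      HasFDerivAt (fun q => dot z (A (F q))) ((dot z).comp ((fderiv ℝ A (F q)).comp FL)) q := by
    intro z q hq
    exact (dot z).hasFDerivAt.comp q ((hAd q hq).hasFDerivAt.comp q (hFd q))
  have hval : ∀ q ∈ Icc (0:ℝ) 1 ×ˢ Icc (0:ℝ) 1,
      ((dot w).comp ((fderiv ℝ A (F q)).comp FL)) (1, 0)
      + (-((dot v).comp ((fderiv ℝ A (F q)).comp FL))) (0, 1) = v.1 * w.2 - v.2 * w.1 := by
    intro q hq
    have := aux_curl A (F q) v w (hAd q hq)
    rw [hcurl _ hq.1 _ hq.2, one_mul] at this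
    rw [← this]
    simp only [_root_.neg_apply, ContinuousLinearMap.comp_apply, hFLs, hFLt, hdotv]
    ring
  have hsub : Ioo (0:ℝ) 1 ×ˢ Ioo (0:ℝ) 1 ⊆ Icc (0:ℝ) 1 ×ˢ Icc (0:ℝ) 1 :=
    prod_mono Ioo_subset_Icc_self Ioo_subset_Icc_self
  have hu : uIcc (0:ℝ) 1 = Icc 0 1 := uIcc_of_le zero_le_one
  have key := integral2_divergence_prod_of_hasFDerivAt (fun q => dot w (A (F q)))
    (fun q => -dot v (A (F q))) (fun q => (dot w).comp ((fderiv ℝ A (F q)).comp FL))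
    (fun q => -((dot v).comp ((fderiv ℝ A (F q)).comp FL))) 0 0 1 1
    (by rw [hu]; exact (dot w).continuous.comp_continuousOn hAc)
    (by rw [hu]; exact ((dot v).continuous.comp_continuousOn hAc).neg)
    (by simp only [zero_le_one, min_eq_left, max_eq_right]; intro q hq; exact hder w q (hsub hq))
    (by simp only [zero_le_one, min_eq_left, max_eq_right]; intro q hq
        exact (hder v q (hsub hq)).neg)
    (by
      rw [hu]
      have hc : IntegrableOn (fun _ : ℝ × ℝ => v.1 * w.2 - v.2 * w.1)
          (Icc (0:ℝ) 1 ×ˢ Icc (0:ℝ) 1) :=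
        continuousOn_const.integrableOn_compact (isCompact_Icc.prod isCompact_Icc)
      exact hc.congr_fun (fun q hq => (hval q hq).symm) (measurableSet_Icc.prod measurableSet_Icc))
  have hl : (∫ s in (0:ℝ)..1, ∫ t in (0:ℝ)..1,
      ((dot w).comp ((fderiv ℝ A (F (s, t))).comp FL)) (1, 0)
      + (-((dot v).comp ((fderiv ℝ A (F (s, t))).comp FL))) (0, 1)) = v.1 * w.2 - v.2 * w.1 := by
    rw [intervalIntegral.integral_congr (g := fun _ => v.1 * w.2 - v.2 * w.1)]
    · simp
    · intro s hs
      rw [hu] at hs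
      simp only
      rw [intervalIntegral.integral_congr (g := fun _ => v.1 * w.2 - v.2 * w.1)]
      · simp
      · intro t ht
        rw [hu] at ht
        exact hval (s, t) ⟨hs, ht⟩
  rw [hl] at key
  simp only [intervalIntegral.integral_neg] at key
  have c1 : circ A x v = ∫ s in (0:ℝ)..1, dot v (A (F (s, 0))) := by
    simp [circ, hdotv, hF]
  have c2 : circ A (x + w) v = ∫ s in (0:ℝ)..1, dot v (A (F (s, 1))) := by
    simp [circ, hdotv, hF, add_right_comm]
  have c3 : circ A x w = ∫ s in (0:ℝ)..1, dot w (A (F (0, s))) := by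
    simp [circ, hdotv, hF]
  have c4 : circ A (x + v) w = ∫ s in (0:ℝ)..1, dot w (A (F (1, s))) := by
    simp [circ, hdotv, hF]
  rw [c1, c2, c3, c4, key]; ring

lemma aux_loop_alg (α₁ α₂ α₃ α₄ β : ℝ) (hβ : α₁ + α₂ - α₃ - α₄ = β) (hβ1 : |β| ≤ 1)
    (u0 u1 u2 u3 : ℂ) :
    β ^ 2 / 4 * ‖u0‖ ^ 2 ≤ 4 * (‖u1 - Complex.exp (Complex.I * (α₁ : ℂ)) * u0‖ ^ 2
      + ‖u2 - Complex.exp (Complex.I * (α₂ : ℂ)) * u1‖ ^ 2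
      + ‖u3 - Complex.exp (Complex.I * (α₃ : ℂ)) * u0‖ ^ 2
      + ‖u2 - Complex.exp (Complex.I * (α₄ : ℂ)) * u3‖ ^ 2) := by
  have hn : ∀ α : ℝ, ‖Complex.exp (Complex.I * (α : ℂ))‖ = 1 := Complex.norm_exp_I_mul_ofReal
  set e₁ := Complex.exp (Complex.I * (α₁ : ℂ)) with he₁
  set e₂ := Complex.exp (Complex.I * (α₂ : ℂ)) with he₂
  set e₃ := Complex.exp (Complex.I * (α₃ : ℂ)) with he₃
  set e₄ := Complex.exp (Complex.I * (α₄ : ℂ)) with he₄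
  have hprod : e₁ * e₂ = e₃ * e₄ * Complex.exp (Complex.I * (β : ℂ)) := by
    rw [he₁, he₂, he₃, he₄, ← Complex.exp_add, ← Complex.exp_add, ← Complex.exp_add, ← hβ]
    congr 1; push_cast; ring
  have hid : e₃ * e₄ * (Complex.exp (Complex.I * (β : ℂ)) - 1) * u0
      = (u2 - e₄ * u3) + e₄ * (u3 - e₃ * u0) - (u2 - e₂ * u1) - e₂ * (u1 - e₁ * u0) := by
    linear_combination (-u0) * hprod
  have h1 : ‖Complex.exp (Complex.I * (β : ℂ)) - 1‖ * ‖u0‖ ≤ ‖u2 - e₄ * u3‖ + ‖u3 - e₃ * u0‖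
      + ‖u2 - e₂ * u1‖ + ‖u1 - e₁ * u0‖ := by
    have e : ‖Complex.exp (Complex.I * (β : ℂ)) - 1‖ * ‖u0‖
        = ‖e₃ * e₄ * (Complex.exp (Complex.I * (β : ℂ)) - 1) * u0‖ := by
      rw [norm_mul, norm_mul, norm_mul, hn, hn]; ring
    rw [e, hid]
    refine (norm_sub_le _ _).trans ?_
    refine add_le_add ((norm_sub_le _ _).trans (add_le_add_left ((norm_add_le _ _).trans ?_) _)) ?_
    · rw [norm_mul, hn, one_mul]
    · rw [norm_mul, hn, one_mul]
  have h2 : |β| / 2 ≤ ‖Complex.exp (Complex.I * (β : ℂ)) - 1‖ := by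
    rw [Complex.norm_exp_I_mul_ofReal_sub_one, norm_mul, Real.norm_eq_abs, Real.norm_eq_abs,
      abs_two]
    have h3 : |sin (β / 2)| = sin (|β| / 2) := by
      rcases le_total 0 β with h | h
      · rw [abs_of_nonneg h, abs_of_nonneg]
        apply sin_nonneg_of_nonneg_of_le_pi (by linarith)
        rw [abs_of_nonneg h] at hβ1
        linarith [Real.pi_gt_three]
      · rw [abs_of_nonpos h, neg_div, sin_neg, abs_of_nonpos]
        apply sin_nonpos_of_nonpos_of_neg_pi_le (by linarith)
        rw [abs_of_nonpos h] at hβ1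
        linarith [Real.pi_gt_three]
    rw [h3]
    have h4 : 2 / π * (|β| / 2) ≤ sin (|β| / 2) :=
      mul_le_sin (by positivity) (by linarith [Real.pi_gt_three])
    have h5 : 1 / 2 ≤ 2 / π := by
      rw [div_le_div_iff₀ (by norm_num) pi_pos]; linarith [pi_le_four]
    nlinarith [abs_nonneg β]
  have h3 : |β| / 2 * ‖u0‖ ≤ ‖u2 - e₄ * u3‖ + ‖u3 - e₃ * u0‖
      + ‖u2 - e₂ * u1‖ + ‖u1 - e₁ * u0‖ :=
    (mul_le_mul_of_nonneg_right h2 (norm_nonneg _)).trans h1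
  have h4 : β ^ 2 / 4 * ‖u0‖ ^ 2 = (|β| / 2 * ‖u0‖) ^ 2 := by
    rw [mul_pow, div_pow, sq_abs]; norm_num
  rw [h4]
  generalize ‖u2 - e₄ * u3‖ = a at *
  generalize ‖u3 - e₃ * u0‖ = b at *
  generalize ‖u2 - e₂ * u1‖ = c at *
  generalize ‖u1 - e₁ * u0‖ = d at *
  calc _ ≤ (a + b + c + d) ^ 2 := by gcongr
    _ ≤ _ := by
      nlinarith [sq_nonneg (a - b), sq_nonneg (a - c), sq_nonneg (a - d), sq_nonneg (b - c),
        sq_nonneg (b - d), sq_nonneg (c - d)]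

/-- The squared magnetic gradient cut off to `S`, as an extended nonnegative function. -/
def mE (S : Set (ℝ × ℝ)) (b : ℝ) (A : ℝ × ℝ → ℝ × ℝ) (u : ℝ × ℝ → ℂ) : ℝ × ℝ → ENNReal :=
  S.indicator (fun y => ENNReal.ofReal (mgNormSq b A u y))

lemma mgNormSq_continuousOn (S : Set (ℝ × ℝ)) (hS : IsOpen S) (b : ℝ) (A : ℝ × ℝ → ℝ × ℝ)
    (u : ℝ × ℝ → ℂ) (hA : ContDiffOn ℝ 1 A S) (hu : ContDiffOn ℝ 1 u S) :
    ContinuousOn (mgNormSq b A u) S := by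
  have hf : ContinuousOn (fderiv ℝ u) S := hu.continuousOn_fderiv_of_isOpen hS le_rfl
  have hA' := hA.continuousOn
  have hu' := hu.continuousOn
  have h1 : ContinuousOn (fun x => ((A x).1 : ℂ)) S :=
    Complex.continuous_ofReal.comp_continuousOn hA'.fst
  have h2 : ContinuousOn (fun x => ((A x).2 : ℂ)) S :=
    Complex.continuous_ofReal.comp_continuousOn hA'.snd
  unfold mgNormSq
  exact (((hf.clm_apply continuousOn_const).sub ((continuousOn_const.mul h1).mul hu')).norm.pow 2).add
    (((hf.clm_apply continuousOn_const).sub ((continuousOn_const.mul h2).mul hu')).norm.pow 2)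

lemma mE_measurable (S : Set (ℝ × ℝ)) (hS : IsOpen S) (b : ℝ) (A : ℝ × ℝ → ℝ × ℝ)
    (u : ℝ × ℝ → ℂ) (hA : ContDiffOn ℝ 1 A S) (hu : ContDiffOn ℝ 1 u S) :
    Measurable (mE S b A u) := by
  classical
  have h := mgNormSq_continuousOn S hS b A u hA hu
  unfold mE
  rw [← Set.piecewise_eq_indicator]
  exact (ENNReal.continuous_ofReal.comp_continuousOn h).measurable_piecewise
    continuousOn_const hS.measurableSet

/-- Average of `mE` over a segment. -/
def segI (m : ℝ × ℝ → ENNReal) (v p : ℝ × ℝ) : ENNReal :=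
  ∫⁻ s in Icc (0:ℝ) 1, m (p + s • v)

lemma segI_measurable (m : ℝ × ℝ → ENNReal) (hm : Measurable m) (v : ℝ × ℝ) :
    Measurable (segI m v) := by
  have : Measurable (fun q : (ℝ × ℝ) × ℝ => m (q.1 + q.2 • v)) := hm.comp (by fun_prop)
  exact this.lintegral_prod_right'

lemma segI_lintegral (m : ℝ × ℝ → ENNReal) (hm : Measurable m) (v c : ℝ × ℝ) :
    ∫⁻ x, segI m v (x + c) = ∫⁻ x, m x := by
  unfold segI
  rw [lintegral_lintegral_swap]
  · have : ∀ s : ℝ, ∫⁻ x : ℝ × ℝ, m (x + c + s • v) = ∫⁻ x, m x := by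
      intro s
      simp only [add_assoc]
      exact lintegral_add_right_eq_self m _
    simp [this]
  · have : Measurable (fun q : (ℝ × ℝ) × ℝ => m (q.1 + c + q.2 • v)) := hm.comp (by fun_prop)
    exact this.aemeasurable

lemma aux_seg_enn (S : Set (ℝ × ℝ)) (hS : IsOpen S) (b : ℝ) (A : ℝ × ℝ → ℝ × ℝ)
    (u : ℝ × ℝ → ℂ) (hA : ContDiffOn ℝ 1 A S) (hu : ContDiffOn ℝ 1 u S) (p v : ℝ × ℝ) (c : ℝ)
    (hc : v.1 ^ 2 + v.2 ^ 2 ≤ c)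
    (hp : ∀ s ∈ Icc (0:ℝ) 1, p + s • v ∈ S) :
    ENNReal.ofReal (‖u (p + v) - Complex.exp (Complex.I * ((b * circ A p v : ℝ) : ℂ)) * u p‖ ^ 2)
      ≤ ENNReal.ofReal c * segI (mE S b A u) v p := by
  have hc0 : 0 ≤ c := le_trans (by positivity) hc
  have hcl : Continuous (fun s : ℝ => p + s • v) := by fun_prop
  have hm0 : ∀ y, 0 ≤ mgNormSq b A u y := fun y => by unfold mgNormSq; positivity
  have hmc : ContinuousOn (fun s : ℝ => mgNormSq b A u (p + s • v)) (Icc 0 1) :=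
    (mgNormSq_continuousOn S hS b A u hA hu).comp hcl.continuousOn hp
  have hAc : ContinuousOn (fun s : ℝ => A (p + s • v)) (Icc 0 1) :=
    hA.continuousOn.comp hcl.continuousOn hp
  have huc : ContinuousOn (fun s : ℝ => u (p + s • v)) (Icc 0 1) :=
    hu.continuousOn.comp hcl.continuousOn hp
  have hfu : ContinuousOn (fun s : ℝ => fderiv ℝ u (p + s • v)) (Icc 0 1) :=
    (hu.continuousOn_fderiv_of_isOpen hS le_rfl).comp hcl.continuousOn hp
  have hcov : ContinuousOn (fun s : ℝ => ‖covD b A u v (p + s • v)‖ ^ 2) (Icc 0 1) := by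
    unfold covD
    refine ((hfu.clm_apply continuousOn_const).sub
      ((continuousOn_const.mul (Complex.continuous_ofReal.comp_continuousOn
        (continuousOn_const.mul ((hAc.fst.mul continuousOn_const).add
          (hAc.snd.mul continuousOn_const))))).mul huc)).norm.pow 2
  have hmi : IntervalIntegrable (fun s : ℝ => c * mgNormSq b A u (p + s • v)) volume 0 1 := by
    apply ContinuousOn.intervalIntegrable
    rw [uIcc_of_le zero_le_one]; exact continuousOn_const.mul hmc
  have h1 : (∫ s in (0:ℝ)..1, ‖covD b A u v (p + s • v)‖ ^ 2)
      ≤ ∫ s in (0:ℝ)..1, c * mgNormSq b A u (p + s • v) := by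
    apply intervalIntegral.integral_mono_on zero_le_one _ hmi
    · intro s _
      exact (covD_le b A u v _).trans (mul_le_mul_of_nonneg_right hc (hm0 _))
    · apply ContinuousOn.intervalIntegrable
      rw [uIcc_of_le zero_le_one]; exact hcov
  have h2 := (aux_seg b A u S hS hA hu p v hp).trans h1
  refine (ENNReal.ofReal_le_ofReal h2).trans ?_
  rw [intervalIntegral.integral_const_mul, ENNReal.ofReal_mul hc0]
  gcongr
  rw [intervalIntegral.integral_of_le zero_le_one, ← integral_Icc_eq_integral_Ioc,
    ofReal_integral_eq_lintegral_ofReal]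
  · unfold segI
    apply le_of_eq
    apply setLIntegral_congr_fun measurableSet_Icc
    intro s hs
    simp only [mE, indicator_of_mem (hp s hs)]
  · exact hmc.integrableOn_compact isCompact_Icc
  · exact Filter.Eventually.of_forall fun s => hm0 _

lemma aux_point (S : Set (ℝ × ℝ)) (hS : IsOpen S) (b : ℝ) (A : ℝ × ℝ → ℝ × ℝ)
    (u : ℝ × ℝ → ℂ) (hA : ContDiffOn ℝ 1 A S) (hu : ContDiffOn ℝ 1 u S)
    (hcurl : ∀ x ∈ S, curl2 A x = 1) (x v w : ℝ × ℝ) (c β : ℝ)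
    (hv : v.1 ^ 2 + v.2 ^ 2 ≤ c) (hw : w.1 ^ 2 + w.2 ^ 2 ≤ c)
    (hβ : b * (v.1 * w.2 - v.2 * w.1) = β) (hβ1 : |β| ≤ 1)
    (hp : ∀ s ∈ Icc (0:ℝ) 1, ∀ t ∈ Icc (0:ℝ) 1, x + s • v + t • w ∈ S) :
    ENNReal.ofReal (β ^ 2 / 4) * ENNReal.ofReal (‖u x‖ ^ 2) ≤
      ENNReal.ofReal (4 * c) * (segI (mE S b A u) v x + segI (mE S b A u) w (x + v)
        + segI (mE S b A u) w x + segI (mE S b A u) v (x + w)) := by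
  have z0 : (0:ℝ) ∈ Icc (0:ℝ) 1 := by simp
  have z1 : (1:ℝ) ∈ Icc (0:ℝ) 1 := by simp
  have hfl := aux_flux A S hS hA x v w hp (fun s hs t ht => hcurl _ (hp s hs t ht))
  have key := aux_loop_alg (b * circ A x v) (b * circ A (x + v) w) (b * circ A x w)
    (b * circ A (x + w) v) β (by rw [← hβ, ← hfl]; ring) hβ1 (u x) (u (x + v)) (u (x + v + w))
    (u (x + w))
  have s1 := aux_seg_enn S hS b A u hA hu x v c hv (fun s hs => by simpa using hp s hs 0 z0)
  have s2 := aux_seg_enn S hS b A u hA hu (x + v) w c hw (fun s hs => by simpa using hp 1 z1 s hs)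
  have s3 := aux_seg_enn S hS b A u hA hu x w c hw (fun s hs => by simpa using hp 0 z0 s hs)
  have s4 := aux_seg_enn S hS b A u hA hu (x + w) v c hv
    (fun s hs => by simpa [add_right_comm] using hp s hs 1 z1)
  rw [add_right_comm x w v] at s4
  rw [← ENNReal.ofReal_mul (by positivity)]
  refine (ENNReal.ofReal_le_ofReal key).trans ?_
  rw [ENNReal.ofReal_mul (by norm_num), ENNReal.ofReal_mul (by norm_num), mul_assoc]
  gcongr
  rw [ENNReal.ofReal_add (by positivity) (by positivity),
    ENNReal.ofReal_add (by positivity) (by positivity),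
    ENNReal.ofReal_add (by positivity) (by positivity), mul_add, mul_add, mul_add]
  gcongr

lemma aux_main (S : Set (ℝ × ℝ)) (hS : IsOpen S) (b h : ℝ) (A : ℝ × ℝ → ℝ × ℝ)
    (u : ℝ × ℝ → ℂ) (hA : ContDiffOn ℝ 1 A S) (hu : ContDiffOn ℝ 1 u S)
    (hcurl : ∀ x ∈ S, curl2 A x = 1) (hb : 0 ≤ b) (hbh : b * h ^ 2 ≤ 1)
    (Sh : Finset ((ℝ × ℝ) × (ℝ × ℝ)))
    (hSh : ∀ k ∈ Sh, |k.1.1 * k.2.2 - k.1.2 * k.2.1| = 1 ∧ k.1.1 ^ 2 + k.1.2 ^ 2 ≤ 2 ∧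
      k.2.1 ^ 2 + k.2.2 ^ 2 ≤ 2)
    (hcov : ∀ x ∈ S, ∃ k ∈ Sh, ∀ s ∈ Icc (0:ℝ) 1, ∀ t ∈ Icc (0:ℝ) 1,
      x + s • (h • k.1) + t • (h • k.2) ∈ S) :
    ENNReal.ofReal ((b * h ^ 2) ^ 2 / 4) * ∫⁻ x in S, ENNReal.ofReal (‖u x‖ ^ 2) ≤
      ENNReal.ofReal (4 * (h ^ 2 * 2)) * (Sh.card * (4 * ∫⁻ x, mE S b A u x)) := by
  set m := mE S b A u with hm
  have hmm : Measurable m := mE_measurable S hS b A u hA hu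
  set T : (ℝ × ℝ) × (ℝ × ℝ) → ℝ × ℝ → ENNReal := fun k x =>
    segI m (h • k.1) x + segI m (h • k.2) (x + h • k.1)
        + segI m (h • k.2) x + segI m (h • k.1) (x + h • k.2) with hT
  have hseg : ∀ v c, Measurable fun x => segI m v (x + c) := fun v c =>
    (segI_measurable m hmm v).comp (by fun_prop)
  have hseg0 : ∀ v, Measurable fun x => segI m v x := fun v => segI_measurable m hmm v
  have hTm : ∀ k, Measurable (T k) := fun k =>
    (((hseg0 _).add (hseg _ _)).add (hseg0 _)).add (hseg _ _)
  have hTi : ∀ k, ∫⁻ x, T k x = 4 * ∫⁻ x, m x := by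
    intro k
    have e0 : ∀ v, ∫⁻ x, segI m v x = ∫⁻ x, m x := fun v => by
      simpa using segI_lintegral m hmm v 0
    simp only [hT]
    rw [lintegral_add_right _ (hseg _ _), lintegral_add_right _ (hseg0 _),
      lintegral_add_right _ (hseg _ _),
      e0, e0, segI_lintegral m hmm, segI_lintegral m hmm]
    ring
  have hpt : ∀ x ∈ S, ENNReal.ofReal ((b * h ^ 2) ^ 2 / 4) * ENNReal.ofReal (‖u x‖ ^ 2)
      ≤ ENNReal.ofReal (4 * (h ^ 2 * 2)) * ∑ k ∈ Sh, T k x := by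
    intro x hx
    obtain ⟨k, hk, hkS⟩ := hcov x hx
    obtain ⟨hd, h1, h2⟩ := hSh k hk
    have hβa : |b * ((h • k.1).1 * (h • k.2).2 - (h • k.1).2 * (h • k.2).1)| = b * h ^ 2 := by
      have : b * ((h • k.1).1 * (h • k.2).2 - (h • k.1).2 * (h • k.2).1)
          = (b * h ^ 2) * (k.1.1 * k.2.2 - k.1.2 * k.2.1) := by
        simp only [Prod.smul_fst, Prod.smul_snd, smul_eq_mul]; ring
      rw [this, abs_mul, hd, mul_one, abs_of_nonneg (by positivity)]
    have := aux_point S hS b A u hA hu hcurl x (h • k.1) (h • k.2) (h ^ 2 * 2) _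
      (by simp only [Prod.smul_fst, Prod.smul_snd, smul_eq_mul]; nlinarith [sq_nonneg h])
      (by simp only [Prod.smul_fst, Prod.smul_snd, smul_eq_mul]; nlinarith [sq_nonneg h])
      rfl (by rw [hβa]; exact hbh) hkS
    rw [← sq_abs, hβa] at this
    refine this.trans ?_
    gcongr
    exact Finset.single_le_sum (f := fun k => T k x) (fun _ _ => zero_le) hk
  calc _ = ∫⁻ x in S, ENNReal.ofReal ((b * h ^ 2) ^ 2 / 4) * ENNReal.ofReal (‖u x‖ ^ 2) := by
        rw [lintegral_const_mul' _ _ ENNReal.ofReal_ne_top]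
    _ ≤ ∫⁻ x in S, ENNReal.ofReal (4 * (h ^ 2 * 2)) * ∑ k ∈ Sh, T k x :=
        setLIntegral_mono' hS.measurableSet hpt
    _ ≤ ∫⁻ x, ENNReal.ofReal (4 * (h ^ 2 * 2)) * ∑ k ∈ Sh, T k x := setLIntegral_le_lintegral _ _
    _ = _ := by
        rw [lintegral_const_mul' _ _ ENNReal.ofReal_ne_top,
          lintegral_finsetSum _ (fun k _ => hTm k)]
        simp [hTi]

lemma aux_stay (Ω : Set (ℝ × ℝ)) (hΩ : IsOpen Ω) (x v w : ℝ × ℝ) (hx : x ∈ Ω)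
    (hp : ∀ s ∈ Icc (0:ℝ) 1, ∀ t ∈ Icc (0:ℝ) 1, x + s • v + t • w ∉ frontier Ω) :
    ∀ s ∈ Icc (0:ℝ) 1, ∀ t ∈ Icc (0:ℝ) 1, x + s • v + t • w ∈ Ω := by
  set F : ℝ × ℝ → ℝ × ℝ := fun q => x + q.1 • v + q.2 • w with hF
  have hFc : Continuous F := by fun_prop
  have hpre : IsPreconnected (F '' (Icc (0:ℝ) 1 ×ˢ Icc (0:ℝ) 1)) :=
    (isPreconnected_Icc.prod isPreconnected_Icc).image F hFc.continuousOn
  have hsub : F '' (Icc (0:ℝ) 1 ×ˢ Icc (0:ℝ) 1) ⊆ Ω := by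
    apply hpre.subset_of_closure_inter_subset hΩ
    · exact ⟨x, ⟨(0, 0), by simp, by simp [hF]⟩, hx⟩
    · rintro y ⟨hy, ⟨q, hq, rfl⟩⟩
      have := hp q.1 hq.1 q.2 hq.2
      by_contra hn
      apply this
      rw [hΩ.frontier_eq]
      exact ⟨hy, hn⟩
  intro s hs t ht
  exact hsub ⟨(s, t), ⟨hs, ht⟩, rfl⟩

/-- Chords of `J` near `p` are flat. -/
def Flat1 (J : Set (ℝ × ℝ)) (p : ℝ × ℝ) (ρ : ℝ) : Prop :=
  ∀ y ∈ J, ∀ z ∈ J, dist y p < ρ → dist z p < ρ → y ≠ z → |y.2 - z.2| < 2 * |y.1 - z.1|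

/-- Chords of `J` near `p` are steep. -/
def Flat2 (J : Set (ℝ × ℝ)) (p : ℝ × ℝ) (ρ : ℝ) : Prop :=
  ∀ y ∈ J, ∀ z ∈ J, dist y p < ρ → dist z p < ρ → y ≠ z → |y.1 - z.1| < 2 * |y.2 - z.2|

lemma aux_num (a b c d δ : ℝ) (hab : a ^ 2 + b ^ 2 = 1) (hba : |b| ≤ |a|) (hδ : δ ≠ 0)
    (h1 : |c - δ * a| ≤ 1 / 10 * |δ|) (h2 : |d - δ * b| ≤ 1 / 10 * |δ|) :
    |d| < 2 * |c| := by
  have hδ' : 0 < |δ| := abs_pos.2 hδ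
  have ha : 1 / 2 ≤ |a| := by
    by_contra hn
    push Not at hn
    have : |b| < 1 / 2 := lt_of_le_of_lt hba hn
    nlinarith [sq_abs a, sq_abs b, abs_nonneg a, abs_nonneg b]
  have e1 : |δ * a| ≤ |c| + 1 / 10 * |δ| := by
    have := abs_sub_abs_le_abs_sub (δ * a) c
    rw [abs_sub_comm] at this
    linarith
  have e2 : |d| ≤ |δ * b| + 1 / 10 * |δ| := by
    have := abs_sub_abs_le_abs_sub d (δ * b)
    linarith
  rw [abs_mul] at e1 e2
  nlinarith

lemma aux_local (Ω : Set (ℝ × ℝ)) (L : ℝ) (hL : 0 < L) (M : ℝ → ℝ × ℝ)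
    (hM : BoundaryParam Ω L M) (p : ℝ × ℝ) (hp : p ∈ frontier Ω) :
    ∃ ρ > 0, Flat1 (frontier Ω) p ρ ∨ Flat2 (frontier Ω) p ρ := by
  obtain ⟨hC, hper, hunit, hinj, hrange⟩ := hM
  rw [← hrange] at hp ⊢
  obtain ⟨t₀, rfl⟩ := hp
  have hMc : Continuous M := hC.continuous
  have hL2 : 0 < 2 * L := by linarith
  have hmod : ∀ a s, M (toIcoMod hL2 a s) = M s := by
    intro a s
    rw [toIcoMod]
    exact hper.sub_zsmul_eq _
  have hstrict : HasStrictDerivAt M (deriv M t₀) t₀ := hC.hasStrictDerivAt (by norm_num)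
  set τ := deriv M t₀ with hτ
  have hlo : ∀ᶠ q : ℝ × ℝ in nhds (t₀, t₀),
      ‖M q.1 - M q.2 - (q.1 - q.2) • τ‖ ≤ 1 / 10 * ‖q.1 - q.2‖ := by
    have h := hstrict.isLittleO
    simpa using h.def (c := 1 / 10) (by norm_num)
  obtain ⟨η, hη, hηb⟩ := Metric.eventually_nhds_iff.1 hlo
  set K : Set ℝ := Icc (t₀ - L) (t₀ + L) \ Ioo (t₀ - η) (t₀ + η) with hK
  have hKc : IsCompact K := isCompact_Icc.diff isOpen_Ioo
  have hq : M t₀ ∉ M '' K := by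
    rintro ⟨s, hs, hst⟩
    have h1 : toIcoMod hL2 0 s = toIcoMod hL2 0 t₀ := by
      apply hinj
      · simpa using toIcoMod_mem_Ico hL2 0 s
      · simpa using toIcoMod_mem_Ico hL2 0 t₀
      · rw [hmod, hmod, hst]
    have h2 : s - t₀ = ((toIcoDiv hL2 0 s - toIcoDiv hL2 0 t₀ : ℤ) : ℝ) * (2 * L) := by
      simp only [toIcoMod, zsmul_eq_mul] at h1
      push_cast; linarith
    set k := toIcoDiv hL2 0 s - toIcoDiv hL2 0 t₀
    obtain ⟨⟨hs1, hs2⟩, hs3⟩ := hs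
    have hk1 : (k : ℝ) < 1 := by nlinarith
    have hk2 : (-1 : ℝ) < k := by nlinarith
    have hk : k = 0 := by
      have a1 : k < 1 := by exact_mod_cast hk1
      have a2 : -1 < k := by exact_mod_cast hk2
      omega
    rw [hk] at h2
    apply hs3
    simp at h2
    constructor <;> linarith
  have hcl : IsClosed (M '' K) := (hKc.image hMc).isClosed
  obtain ⟨ρ, hρ, hρb⟩ := Metric.isOpen_iff.1 hcl.isOpen_compl (M t₀) hq
  have hnear : ∀ y ∈ range M, dist y (M t₀) < ρ → ∃ s, M s = y ∧ |s - t₀| < η := by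
    rintro _ ⟨s, rfl⟩ hd
    refine ⟨toIcoMod hL2 (t₀ - L) s, hmod _ _, ?_⟩
    have hm := toIcoMod_mem_Ico hL2 (t₀ - L) s
    by_contra hn
    have : M s ∈ (M '' K)ᶜ := hρb hd
    apply this
    refine ⟨toIcoMod hL2 (t₀ - L) s, ⟨⟨hm.1, by linarith [hm.2]⟩, ?_⟩, hmod _ _⟩
    intro hI
    apply hn
    rw [abs_lt]
    constructor <;> linarith [hI.1, hI.2]
  have hch : ∀ y ∈ range M, ∀ z ∈ range M, dist y (M t₀) < ρ → dist z (M t₀) < ρ → y ≠ z →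
      ∃ δ : ℝ, δ ≠ 0 ∧ |(y.1 - z.1) - δ * τ.1| ≤ 1 / 10 * |δ| ∧
        |(y.2 - z.2) - δ * τ.2| ≤ 1 / 10 * |δ| := by
    intro y hy z hz hyd hzd hne
    obtain ⟨s, rfl, hs⟩ := hnear y hy hyd
    obtain ⟨t, rfl, ht⟩ := hnear z hz hzd
    have := hηb (y := (s, t)) (by
      rw [Prod.dist_eq]
      exact max_lt (by simpa [Real.dist_eq] using hs) (by simpa [Real.dist_eq] using ht))
    refine ⟨s - t, fun h0 => hne (by rw [sub_eq_zero.1 h0]), ?_, ?_⟩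
    · exact (norm_fst_le _).trans this
    · exact (norm_snd_le _).trans this
  refine ⟨ρ, hρ, ?_⟩
  have hu : τ.1 ^ 2 + τ.2 ^ 2 = 1 := hunit t₀
  rcases le_total |τ.2| |τ.1| with h | h
  · left
    intro y hy z hz hyd hzd hne
    obtain ⟨δ, h0, h1, h2⟩ := hch y hy z hz hyd hzd hne
    exact aux_num τ.1 τ.2 _ _ δ hu h h0 h1 h2
  · right
    intro y hy z hz hyd hzd hne
    obtain ⟨δ, h0, h1, h2⟩ := hch y hy z hz hyd hzd hne
    exact aux_num τ.2 τ.1 _ _ δ (by linarith) h h0 h2 h1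

lemma aux_J_compact (Ω : Set (ℝ × ℝ)) (hΩb : Bornology.IsBounded Ω) : IsCompact (frontier Ω) :=
  Metric.isCompact_of_isClosed_isBounded isClosed_frontier
    (hΩb.closure.subset frontier_subset_closure)

lemma aux_uniform (Ω : Set (ℝ × ℝ)) (hΩb : Bornology.IsBounded Ω) (L : ℝ) (hL : 0 < L)
    (M : ℝ → ℝ × ℝ) (hM : BoundaryParam Ω L M) :
    ∃ ρ > 0, ∀ p ∈ frontier Ω, Flat1 (frontier Ω) p ρ ∨ Flat2 (frontier Ω) p ρ := by
  choose r hr hflat using fun p : frontier Ω => aux_local Ω L hL M hM p p.2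
  obtain ⟨δ, hδ, hb⟩ := lebesgue_number_lemma_of_metric (c := fun p : frontier Ω =>
    Metric.ball (p : ℝ × ℝ) (r p)) (aux_J_compact Ω hΩb) (fun _ => Metric.isOpen_ball)
    (fun p hp => mem_iUnion.2 ⟨⟨p, hp⟩, Metric.mem_ball_self (hr _)⟩)
  refine ⟨δ, hδ, fun p hp => ?_⟩
  obtain ⟨i, hi⟩ := hb p hp
  rcases hflat i with h | h
  · left
    intro y hy z hz hyd hzd
    exact h y hy z hz (hi hyd) (hi hzd)
  · right
    intro y hy z hz hyd hzd
    exact h y hy z hz (hi hyd) (hi hzd)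

/-- The eight model parallelograms. -/
def shapes : Finset ((ℝ × ℝ) × (ℝ × ℝ)) :=
  {((1, 0), (0, 1)), ((1, 0), (0, -1)), ((-1, 0), (0, 1)), ((-1, 0), (0, -1)),
   ((1/2, 1), (-1/2, 1)), ((1/2, -1), (-1/2, -1)), ((1, 1/2), (1, -1/2)), ((-1, 1/2), (-1, -1/2))}

lemma shapes_card : shapes.card ≤ 8 := by
  unfold shapes
  exact (Finset.card_insert_le _ _).trans (Nat.succ_le_succ
    ((Finset.card_insert_le _ _).trans (Nat.succ_le_succ Finset.card_le_six)))

lemma shapes_prop : ∀ k ∈ shapes, |k.1.1 * k.2.2 - k.1.2 * k.2.1| = 1 ∧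
    k.1.1 ^ 2 + k.1.2 ^ 2 ≤ 2 ∧ k.2.1 ^ 2 + k.2.2 ^ 2 ≤ 2 := by
  intro k hk
  simp only [shapes, Finset.mem_insert, Finset.mem_singleton] at hk
  rcases hk with rfl | rfl | rfl | rfl | rfl | rfl | rfl | rfl <;> norm_num

lemma aux_away (Ω : Set (ℝ × ℝ)) (hΩo : IsOpen Ω) (ε h : ℝ) (hh : 0 < h) (hhε : h ≤ ε / 8)
    (x p : ℝ × ℝ) (hx : x ∈ Ω) (hp : p ∈ frontier Ω) (hd : Metric.infDist x (frontier Ω) = dist x p)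
    (hdε : dist x p < ε) (hfar : ε / 2 ≤ dist x p) :
    ∃ k ∈ shapes, ∀ s ∈ Icc (0:ℝ) 1, ∀ t ∈ Icc (0:ℝ) 1,
      x + s • (h • k.1) + t • (h • k.2) ∈ OmegaEps Ω ε := by
  have hε : 0 < ε := by linarith
  rw [Prod.dist_eq, max_lt_iff, Real.dist_eq, Real.dist_eq, abs_lt, abs_lt] at hdε
  have main : ∀ σ₁ σ₂ : ℝ, (σ₁ = 1 ∧ x.1 ≤ p.1 ∨ σ₁ = -1 ∧ p.1 ≤ x.1) →
      (σ₂ = 1 ∧ x.2 ≤ p.2 ∨ σ₂ = -1 ∧ p.2 ≤ x.2) → ∀ s ∈ Icc (0:ℝ) 1, ∀ t ∈ Icc (0:ℝ) 1,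
      x + s • (h • ((σ₁, 0) : ℝ × ℝ)) + t • (h • ((0, σ₂) : ℝ × ℝ)) ∈ OmegaEps Ω ε := by
    intro σ₁ σ₂ h1 h2
    have hst := aux_stay Ω hΩo x (h • ((σ₁, 0) : ℝ × ℝ)) (h • ((0, σ₂) : ℝ × ℝ)) hx (by
      intro s hs t ht hJ
      have h3 := Metric.infDist_le_dist_of_mem (x := x) hJ
      rw [hd] at h3
      have h4 : dist x (x + s • (h • ((σ₁, 0) : ℝ × ℝ)) + t • (h • ((0, σ₂) : ℝ × ℝ))) < ε / 2 := by
        rw [Prod.dist_eq, Real.dist_eq, Real.dist_eq]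
        simp only [Prod.fst_add, Prod.snd_add, Prod.smul_fst, Prod.smul_snd, smul_eq_mul]
        apply max_lt <;> rw [abs_lt] <;> constructor <;>
        rcases h1 with ⟨rfl, _⟩ | ⟨rfl, _⟩ <;> rcases h2 with ⟨rfl, _⟩ | ⟨rfl, _⟩ <;>
        nlinarith [hs.1, hs.2, ht.1, ht.2]
      linarith)
    intro s hs t ht
    refine ⟨hst s hs t ht, lt_of_le_of_lt (Metric.infDist_le_dist_of_mem hp) ?_⟩
    rw [Prod.dist_eq, Real.dist_eq, Real.dist_eq]
    simp only [Prod.fst_add, Prod.snd_add, Prod.smul_fst, Prod.smul_snd, smul_eq_mul]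
    have hs' : 0 ≤ s * h ∧ s * h ≤ h := ⟨mul_nonneg hs.1 hh.le, by nlinarith [hs.2]⟩
    have ht' : 0 ≤ t * h ∧ t * h ≤ h := ⟨mul_nonneg ht.1 hh.le, by nlinarith [ht.2]⟩
    apply max_lt <;> rw [abs_lt] <;> constructor <;>
      rcases h1 with ⟨rfl, _⟩ | ⟨rfl, _⟩ <;> rcases h2 with ⟨rfl, _⟩ | ⟨rfl, _⟩ <;>
      linarith [hdε.1.1, hdε.1.2, hdε.2.1, hdε.2.2]
  rcases le_total x.1 p.1 with h1 | h1 <;> rcases le_total x.2 p.2 with h2 | h2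
  · exact ⟨((1, 0), (0, 1)), by simp [shapes], main 1 1 (Or.inl ⟨rfl, h1⟩) (Or.inl ⟨rfl, h2⟩)⟩
  · exact ⟨((1, 0), (0, -1)), by simp [shapes], main 1 (-1) (Or.inl ⟨rfl, h1⟩) (Or.inr ⟨rfl, h2⟩)⟩
  · exact ⟨((-1, 0), (0, 1)), by simp [shapes], main (-1) 1 (Or.inr ⟨rfl, h1⟩) (Or.inl ⟨rfl, h2⟩)⟩
  · exact ⟨((-1, 0), (0, -1)), by simp [shapes],
      main (-1) (-1) (Or.inr ⟨rfl, h1⟩) (Or.inr ⟨rfl, h2⟩)⟩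

lemma aux_near (Ω : Set (ℝ × ℝ)) (hΩo : IsOpen Ω) (ε h ρ : ℝ) (hh : 0 < h) (hhε : h ≤ ε / 8)
    (hερ : ε ≤ ρ)
    (x p : ℝ × ℝ) (hx : x ∈ Ω) (hp : p ∈ frontier Ω) (hclose : dist x p < ε / 2)
    (hflat : Flat1 (frontier Ω) p ρ ∨ Flat2 (frontier Ω) p ρ) :
    ∃ k ∈ shapes, ∀ s ∈ Icc (0:ℝ) 1, ∀ t ∈ Icc (0:ℝ) 1,
      x + s • (h • k.1) + t • (h • k.2) ∈ OmegaEps Ω ε := by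
  have hxJ : x ∉ frontier Ω := by
    rw [hΩo.frontier_eq]; exact fun hn => hn.2 hx
  have hdist : ∀ k ∈ shapes, ∀ s ∈ Icc (0:ℝ) 1, ∀ t ∈ Icc (0:ℝ) 1,
      dist (x + s • (h • k.1) + t • (h • k.2)) p < ε := by
    intro k hk s hs t ht
    have hs' : 0 ≤ s * h ∧ s * h ≤ h := ⟨mul_nonneg hs.1 hh.le, by nlinarith [hs.2]⟩
    have ht' : 0 ≤ t * h ∧ t * h ≤ h := ⟨mul_nonneg ht.1 hh.le, by nlinarith [ht.2]⟩
    have hk' : (|k.1.1| ≤ 1 ∧ |k.1.2| ≤ 1) ∧ (|k.2.1| ≤ 1 ∧ |k.2.2| ≤ 1) := by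
      simp only [shapes, Finset.mem_insert, Finset.mem_singleton] at hk
      rcases hk with rfl | rfl | rfl | rfl | rfl | rfl | rfl | rfl <;>
        norm_num [abs_le]
    simp only [abs_le] at hk'
    have h1 : dist (x + s • (h • k.1) + t • (h • k.2)) x ≤ 2 * h := by
      rw [Prod.dist_eq, Real.dist_eq, Real.dist_eq]
      simp only [Prod.fst_add, Prod.snd_add, Prod.smul_fst, Prod.smul_snd, smul_eq_mul]
      apply max_le <;> rw [abs_le] <;> constructor <;> nlinarith
    linarith [dist_triangle (x + s • (h • k.1) + t • (h • k.2)) x p]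
  have fin : ∀ k ∈ shapes, (∀ s ∈ Icc (0:ℝ) 1, ∀ t ∈ Icc (0:ℝ) 1,
      x + s • (h • k.1) + t • (h • k.2) ∉ frontier Ω) → ∃ k ∈ shapes, ∀ s ∈ Icc (0:ℝ) 1,
      ∀ t ∈ Icc (0:ℝ) 1, x + s • (h • k.1) + t • (h • k.2) ∈ OmegaEps Ω ε := by
    intro k hk hf
    refine ⟨k, hk, fun s hs t ht => ⟨aux_stay Ω hΩo x _ _ hx hf s hs t ht, ?_⟩⟩
    exact lt_of_le_of_lt (Metric.infDist_le_dist_of_mem hp) (hdist k hk s hs t ht)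
  rcases hflat with hfl | hfl
  · set k₁ : (ℝ × ℝ) × (ℝ × ℝ) := ((1/2, 1), (-1/2, 1)) with hk₁
    set k₂ : (ℝ × ℝ) × (ℝ × ℝ) := ((1/2, -1), (-1/2, -1)) with hk₂
    have m₁ : k₁ ∈ shapes := by simp [shapes, hk₁]
    have m₂ : k₂ ∈ shapes := by simp [shapes, hk₂]
    by_cases c₁ : ∀ s ∈ Icc (0:ℝ) 1, ∀ t ∈ Icc (0:ℝ) 1,
      x + s • (h • k₁.1) + t • (h • k₁.2) ∉ frontier Ω
    · exact fin k₁ m₁ c₁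
    refine fin k₂ m₂ ?_
    push Not at c₁
    obtain ⟨s, hs, t, ht, hy⟩ := c₁
    intro s' hs' t' ht' hz
    have hyd := hdist k₁ m₁ s hs t ht
    have hzd := hdist k₂ m₂ s' hs' t' ht'
    have key := hfl _ hy _ hz (hyd.trans_le hερ) (hzd.trans_le hερ)
    have p1 : 0 ≤ s * h := mul_nonneg hs.1 hh.le
    have p2 : 0 ≤ t * h := mul_nonneg ht.1 hh.le
    have p3 : 0 ≤ s' * h := mul_nonneg hs'.1 hh.le
    have p4 : 0 ≤ t' * h := mul_nonneg ht'.1 hh.le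
    have hpos : ¬ (s * h + t * h = 0) := by
      intro h0
      have e1 : s = 0 := by
        have : s * h = 0 := by linarith
        exact (mul_eq_zero.1 this).resolve_right hh.ne'
      have e2 : t = 0 := by
        have : t * h = 0 := by linarith
        exact (mul_eq_zero.1 this).resolve_right hh.ne'
      apply hxJ
      simpa [e1, e2] using hy
    have hne : x + s • (h • k₁.1) + t • (h • k₁.2) ≠ x + s' • (h • k₂.1) + t' • (h • k₂.2) := by
      intro he
      have := congrArg Prod.snd he
      simp only [hk₁, hk₂, Prod.snd_add, Prod.smul_snd, smul_eq_mul] at this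
      apply hpos; linarith
    have k2 := key hne
    simp only [hk₁, hk₂, Prod.fst_add, Prod.snd_add, Prod.smul_fst, Prod.smul_snd, smul_eq_mul]
      at k2
    refine absurd k2 (not_lt.2 ?_)
    rw [← abs_two, ← abs_mul, abs_two]
    refine le_trans (abs_le.2 ⟨?_, ?_⟩) (le_abs_self _) <;> linarith
  · set k₁ : (ℝ × ℝ) × (ℝ × ℝ) := ((1, 1/2), (1, -1/2)) with hk₁
    set k₂ : (ℝ × ℝ) × (ℝ × ℝ) := ((-1, 1/2), (-1, -1/2)) with hk₂
    have m₁ : k₁ ∈ shapes := by simp [shapes, hk₁]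
    have m₂ : k₂ ∈ shapes := by simp [shapes, hk₂]
    by_cases c₁ : ∀ s ∈ Icc (0:ℝ) 1, ∀ t ∈ Icc (0:ℝ) 1,
      x + s • (h • k₁.1) + t • (h • k₁.2) ∉ frontier Ω
    · exact fin k₁ m₁ c₁
    refine fin k₂ m₂ ?_
    push Not at c₁
    obtain ⟨s, hs, t, ht, hy⟩ := c₁
    intro s' hs' t' ht' hz
    have hyd := hdist k₁ m₁ s hs t ht
    have hzd := hdist k₂ m₂ s' hs' t' ht'
    have key := hfl _ hy _ hz (hyd.trans_le hερ) (hzd.trans_le hερ)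
    have p1 : 0 ≤ s * h := mul_nonneg hs.1 hh.le
    have p2 : 0 ≤ t * h := mul_nonneg ht.1 hh.le
    have p3 : 0 ≤ s' * h := mul_nonneg hs'.1 hh.le
    have p4 : 0 ≤ t' * h := mul_nonneg ht'.1 hh.le
    have hpos : ¬ (s * h + t * h = 0) := by
      intro h0
      have e1 : s = 0 := by
        have : s * h = 0 := by linarith
        exact (mul_eq_zero.1 this).resolve_right hh.ne'
      have e2 : t = 0 := by
        have : t * h = 0 := by linarith
        exact (mul_eq_zero.1 this).resolve_right hh.ne'
      apply hxJ
      simpa [e1, e2] using hy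
    have hne : x + s • (h • k₁.1) + t • (h • k₁.2) ≠ x + s' • (h • k₂.1) + t' • (h • k₂.2) := by
      intro he
      have := congrArg Prod.fst he
      simp only [hk₁, hk₂, Prod.fst_add, Prod.smul_fst, smul_eq_mul] at this
      apply hpos; linarith
    have k2 := key hne
    simp only [hk₁, hk₂, Prod.fst_add, Prod.snd_add, Prod.smul_fst, Prod.smul_snd, smul_eq_mul]
      at k2
    refine absurd k2 (not_lt.2 ?_)
    rw [← abs_two, ← abs_mul, abs_two]
    refine le_trans (abs_le.2 ⟨?_, ?_⟩) (le_abs_self _) <;> linarith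

lemma aux_omega_open (Ω : Set (ℝ × ℝ)) (hΩo : IsOpen Ω) (ε : ℝ) : IsOpen (OmegaEps Ω ε) :=
  hΩo.inter (isOpen_lt (Metric.continuous_infDist_pt _) continuous_const)

lemma aux_integrable (S : Set (ℝ × ℝ)) (hSb : Bornology.IsBounded S) (f : ℝ × ℝ → ℝ)
    (hf : ContinuousOn f (closure S)) : IntegrableOn f S :=
  (hf.integrableOn_compact (Metric.isCompact_of_isClosed_isBounded isClosed_closure
    hSb.closure)).mono_set subset_closure

lemma aux_rayleigh (S : Set (ℝ × ℝ)) (hS : IsOpen S) (hSb : Bornology.IsBounded S) (b h : ℝ)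
    (A : ℝ × ℝ → ℝ × ℝ) (u : ℝ × ℝ → ℂ) (hA : C1Nhd A S) (hu : C1Nhd u S)
    (hcurl : ∀ x ∈ S, curl2 A x = 1) (hb : 0 ≤ b) (hh : 0 < h) (hbh : b * h ^ 2 ≤ 1)
    (hcov : ∀ x ∈ S, ∃ k ∈ shapes, ∀ s ∈ Icc (0:ℝ) 1, ∀ t ∈ Icc (0:ℝ) 1,
      x + s • (h • k.1) + t • (h • k.2) ∈ S) :
    (b * h) ^ 2 * ∫ x in S, ‖u x‖ ^ 2 ≤ 1024 * ∫ x in S, mgNormSq b A u x := by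
  obtain ⟨U, hU, hSU, hAU⟩ := hA
  obtain ⟨V, hV, hSV, huV⟩ := hu
  have hsub : S ⊆ closure S := subset_closure
  have main := aux_main S hS b h A u (hAU.mono (hsub.trans hSU)) (huV.mono (hsub.trans hSV))
    hcurl hb hbh shapes shapes_prop hcov
  have hm0 : ∀ y, 0 ≤ mgNormSq b A u y := fun y => by unfold mgNormSq; positivity
  have hmc : ContinuousOn (mgNormSq b A u) (closure S) :=
    (mgNormSq_continuousOn (U ∩ V) (hU.inter hV) b A u (hAU.mono inter_subset_left)
      (huV.mono inter_subset_right)).mono (subset_inter hSU hSV)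
  have huc : ContinuousOn (fun x => ‖u x‖ ^ 2) (closure S) :=
    (huV.continuousOn.mono hSV).norm.pow 2
  have e1 : ∫⁻ x in S, ENNReal.ofReal (‖u x‖ ^ 2) = ENNReal.ofReal (∫ x in S, ‖u x‖ ^ 2) :=
    (ofReal_integral_eq_lintegral_ofReal (aux_integrable S hSb _ huc)
      (Filter.Eventually.of_forall fun x => by positivity)).symm
  have e2 : ∫⁻ x, mE S b A u x = ENNReal.ofReal (∫ x in S, mgNormSq b A u x) := by
    unfold mE
    rw [lintegral_indicator hS.measurableSet]
    exact (ofReal_integral_eq_lintegral_ofReal (aux_integrable S hSb _ hmc)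
      (Filter.Eventually.of_forall fun x => hm0 x)).symm
  have hI : 0 ≤ ∫ x in S, mgNormSq b A u x := integral_nonneg hm0
  have hcard : (shapes.card : ENNReal) ≤ ENNReal.ofReal 8 := by
    have : (shapes.card : ENNReal) ≤ ((8 : ℕ) : ENNReal) := by exact_mod_cast shapes_card
    simpa using this
  have h4 : (4 : ENNReal) = ENNReal.ofReal 4 := by simp
  rw [e1, e2] at main
  have main2 : ENNReal.ofReal ((b * h ^ 2) ^ 2 / 4) * ENNReal.ofReal (∫ x in S, ‖u x‖ ^ 2)
      ≤ ENNReal.ofReal (4 * (h ^ 2 * 2)) * (ENNReal.ofReal 8 * (ENNReal.ofReal 4 *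
        ENNReal.ofReal (∫ x in S, mgNormSq b A u x))) := by
    refine main.trans ?_
    rw [h4]
    gcongr
  rw [← ENNReal.ofReal_mul (by positivity), ← ENNReal.ofReal_mul (by positivity),
    ← ENNReal.ofReal_mul (by positivity), ← ENNReal.ofReal_mul (by positivity),
    ENNReal.ofReal_le_ofReal_iff (by positivity)] at main2
  have hh2 : 0 < h ^ 2 := by positivity
  refine le_of_mul_le_mul_left ?_ hh2
  nlinarith

/-- In the thin-domain limit, the lowest magnetic Neumann eigenvalue blows up
when the field strength is large compared with the inverse thickness. -/
theorem stmt_1 (Ω : Set (ℝ × ℝ)) (hΩo : IsOpen Ω) (hΩb : Bornology.IsBounded Ω)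
    (hΩsc : SimplyConnectedSpace ↥Ω)
    (L : ℝ) (hL : 0 < L) (M : ℝ → ℝ × ℝ) (hM : BoundaryParam Ω L M)
    (A : ℝ × ℝ → ℝ × ℝ) (hA : C1Nhd A Ω) (hcurl : ∀ x ∈ Ω, curl2 A x = 1) :
    ∀ N > (0 : ℝ), ∃ ε₀ > 0, ∃ d₀ > 0, ∀ ε ∈ Set.Ioc (0 : ℝ) ε₀,
      ∀ b ≥ (0 : ℝ), ε * b ≥ d₀ → lam Ω A ε b ≥ N := by
  intro N hN
  obtain ⟨ρ, hρ, hflat⟩ := aux_uniform Ω hΩb L hL M hM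
  set K : ℝ := 32 * √N with hK
  have hK0 : 0 < K := by positivity
  have hK2 : K ^ 2 = 1024 * N := by
    rw [hK, mul_pow, Real.sq_sqrt hN.le]; norm_num
  refine ⟨min ρ (8 / K), lt_min hρ (by positivity), 8 * K, by positivity, ?_⟩
  rintro ε ⟨hε, hε0⟩ b hb hεb
  have hb0 : 0 < b := by
    rcases hb.lt_or_eq with h | h
    · exact h
    · rw [← h] at hεb; linarith
  have hερ : ε ≤ ρ := hε0.trans (min_le_left _ _)
  have hεK : ε * K ≤ 8 := (le_div_iff₀ hK0).1 (hε0.trans (min_le_right _ _))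
  have hbK : K ^ 2 ≤ b := by
    refine le_of_mul_le_mul_left ?_ hε
    nlinarith
  set h : ℝ := K / b with hh
  have hh0 : 0 < h := by positivity
  have hbhK : b * h = K := by rw [hh]; field_simp
  have hhε : h ≤ ε / 8 := by
    rw [hh, div_le_iff₀ hb0]; linarith
  have hbh : b * h ^ 2 ≤ 1 := by
    have : b * h ^ 2 = K ^ 2 / b := by rw [hh]; field_simp
    rw [this]; exact (div_le_one hb0).2 hbK
  set S := OmegaEps Ω ε with hS
  have hSΩ : S ⊆ Ω := fun x hx => hx.1
  have hSo : IsOpen S := aux_omega_open Ω hΩo ε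
  have hSb : Bornology.IsBounded S := hΩb.subset hSΩ
  have hJne : (frontier Ω).Nonempty := by
    rw [← hM.2.2.2.2]; exact range_nonempty M
  have hcov : ∀ x ∈ S, ∃ k ∈ shapes, ∀ s ∈ Icc (0:ℝ) 1, ∀ t ∈ Icc (0:ℝ) 1,
      x + s • (h • k.1) + t • (h • k.2) ∈ S := by
    rintro x ⟨hx, hxd⟩
    obtain ⟨p, hp, hpd⟩ := (aux_J_compact Ω hΩb).exists_infDist_eq_dist hJne x
    rcases lt_or_ge (dist x p) (ε / 2) with hc | hc
    · exact aux_near Ω hΩo ε h ρ hh0 hhε hερ x p hx hp hc (hflat p hp)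
    · exact aux_away Ω hΩo ε h hh0 hhε x p hx hp hpd (hpd ▸ hxd) hc
  have hAS : C1Nhd A S := by
    obtain ⟨U, hU, hSU, hAU⟩ := hA
    exact ⟨U, hU, (closure_mono hSΩ).trans hSU, hAU⟩
  unfold lam
  refine le_csInf ?_ ?_
  · refine ⟨_, fun _ => 1, ⟨univ, isOpen_univ, subset_univ _, contDiffOn_const⟩, ?_, rfl⟩
    have hne : S.Nonempty := by
      obtain ⟨p, hp⟩ := hJne
      obtain ⟨y, hy, hyd⟩ := Metric.mem_closure_iff.1 (frontier_subset_closure hp) ε hε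
      refine ⟨y, hy, lt_of_le_of_lt (Metric.infDist_le_dist_of_mem hp) ?_⟩
      rwa [dist_comm]
    have hpos : 0 < volume S := hSo.measure_pos volume hne
    have hfin : volume S ≠ ⊤ := hSb.measure_lt_top.ne
    simpa [Measure.real] using ENNReal.toReal_pos hpos.ne' hfin
  · rintro r ⟨u, hu, hpos, rfl⟩
    have key := aux_rayleigh S hSo hSb b h A u hAS hu (fun x hx => hcurl x (hSΩ hx)) hb hh0 hbh hcov
    rw [hbhK, hK2] at key
    rw [le_div_iff₀ hpos]
    linarith
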